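/- arXiv:2409.20027 — 7 statements merged into one kernel-verified Lean document; each statement's English description precedes it below -/
import Mathlib

section
/- The co-state combination operator is associative: on the set of triples (a, b, C) with a, b ∈ ℝ^n and C an n×n real matrix, define (a₁, b₁, C₁) ⊗ (a₂, b₂, C₂) = (a₁ + C₁ᵀ a₂, b₁ + C₁ᵀ b₂, C₂ C₁). Then for all triples e₁, e₂, e₃ one has (e₁ ⊗ e₂) ⊗ e₃ = e₁ ⊗ (e₂ ⊗ e₃). -/
open Matrix

/-- The co-state scan element combination: on triples `(a, b, C)` with `a, b ∈ ℝⁿ` and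
`C` an `n × n` real matrix, `(a₁, b₁, C₁) ⊗ (a₂, b₂, C₂) = (a₁ + C₁ᵀ a₂, b₁ + C₁ᵀ b₂, C₂ C₁)`. -/
def costateOp (n : ℕ)
    (e₁ e₂ : (Fin n → ℝ) × (Fin n → ℝ) × Matrix (Fin n) (Fin n) ℝ) :
    (Fin n → ℝ) × (Fin n → ℝ) × Matrix (Fin n) (Fin n) ℝ :=
  (e₁.1 + (e₁.2.2)ᵀ.mulVec e₂.1,
   e₁.2.1 + (e₁.2.2)ᵀ.mulVec e₂.2.1,
   e₂.2.2 * e₁.2.2)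

/-- The co-state combination operator is associative. -/
theorem costateOp_assoc (n : ℕ)
    (e₁ e₂ e₃ : (Fin n → ℝ) × (Fin n → ℝ) × Matrix (Fin n) (Fin n) ℝ) :
    costateOp n (costateOp n e₁ e₂) e₃ = costateOp n e₁ (costateOp n e₂ e₃) := by
  simp [costateOp, mulVec_add, Matrix.mul_assoc, add_assoc]
end

section
/- Correctness of the parallel co-state scan: let N ≥ 1, let p_t, q_t ∈ ℝ^n and F_t ∈ M_n(ℝ) for 1 ≤ t ≤ N, and let λ_{N+1} ∈ ℝ^n. Define the co-state sequence backwards by λ_t = p_t + q_t + F_tᵀ λ_{t+1} for t = N, N−1, …, 1. Define scan elements a_N = (p_N + F_Nᵀ λ_{N+1}, q_N, 0) and a_t = (p_t, q_t, F_t) for 1 ≤ t < N, combined with the operation (a₁, b₁, C₁) ⊗ (a₂, b₂, C₂) = (a₁ + C₁ᵀ a₂, b₁ + C₁ᵀ b₂, C₂ C₁). Then for every 1 ≤ t ≤ N, writing a_t ⊗ a_{t+1} ⊗ ⋯ ⊗ a_N = (A, B, C), one has λ_t = A + B (and C = 0). -/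
open Matrix

/-- The combination `a_t ⊗ a_{t+1} ⊗ ⋯ ⊗ a_N` of the scan elements from `t` to `N`. -/
def costateScan (n N : ℕ)
    (a : ℕ → (Fin n → ℝ) × (Fin n → ℝ) × Matrix (Fin n) (Fin n) ℝ) (t : ℕ) :
    (Fin n → ℝ) × (Fin n → ℝ) × Matrix (Fin n) (Fin n) ℝ :=
  (((List.range' t (N - t)).map a).foldr (costateOp n) (a N))

theorem costateScan_self (n N : ℕ)
    (a : ℕ → (Fin n → ℝ) × (Fin n → ℝ) × Matrix (Fin n) (Fin n) ℝ) :
    costateScan n N a N = a N := by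
  simp [costateScan]

theorem costateScan_of_lt (n N : ℕ)
    (a : ℕ → (Fin n → ℝ) × (Fin n → ℝ) × Matrix (Fin n) (Fin n) ℝ) {t : ℕ} (ht : t < N) :
    costateScan n N a t = costateOp n (a t) (costateScan n N a (t + 1)) := by
  have h : N - t = (N - (t + 1)) + 1 := by omega
  simp only [costateScan, h, List.range'_succ, List.map_cons, List.foldr_cons]

/-- Correctness of the parallel co-state scan: the co-state sequence defined by the backward
affine recursion `λ_t = p_t + q_t + F_tᵀ λ_{t+1}` is recovered from the prefix combinations
of the scan elements `a_N = (p_N + F_Nᵀ λ_{N+1}, q_N, 0)`, `a_t = (p_t, q_t, F_t)` for `t < N`: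
writing `a_t ⊗ ⋯ ⊗ a_N = (A, B, C)`, one has `λ_t = A + B` and `C = 0`. -/
theorem costate_scan_correct (n N : ℕ) (hN : 1 ≤ N)
    (p q : ℕ → (Fin n → ℝ)) (F : ℕ → Matrix (Fin n) (Fin n) ℝ)
    (lam : ℕ → (Fin n → ℝ))
    (hlam : ∀ t, 1 ≤ t → t ≤ N → lam t = p t + q t + (F t)ᵀ.mulVec (lam (t + 1)))
    (a : ℕ → (Fin n → ℝ) × (Fin n → ℝ) × Matrix (Fin n) (Fin n) ℝ)
    (haN : a N = (p N + (F N)ᵀ.mulVec (lam (N + 1)), q N, 0))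
    (hat : ∀ t, 1 ≤ t → t < N → a t = (p t, q t, F t)) :
    ∀ t, 1 ≤ t → t ≤ N →
      lam t = (costateScan n N a t).1 + (costateScan n N a t).2.1
        ∧ (costateScan n N a t).2.2 = 0 := by
  intro t ht htN
  induction htN using Nat.decreasingInduction with
  | self =>
    rw [costateScan_self, haN, hlam N hN le_rfl]
    exact ⟨add_right_comm _ _ _, rfl⟩
  | of_succ t htN ih =>
    obtain ⟨hsum, hzero⟩ := ih (Nat.le_add_left 1 t)
    rw [costateScan_of_lt n N a htN, hat t ht htN, hlam t ht htN.le, hsum]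
    refine ⟨?_, ?_⟩
    · simp only [costateOp, mulVec_add]
      abel
    · simp only [costateOp, hzero, zero_mul]
end

section
/- Correctness of the parallel state-propagation scan: let N ≥ 1, let F_t ∈ M_n(ℝ) and e_t ∈ ℝ^n for 1 ≤ t ≤ N, let x₁ ∈ ℝ^n, and define the trajectory forwards by x_{t+1} = F_t x_t + e_t. Define scan elements ϑ₁ = (0, F₁ x₁ + e₁) and ϑ_t = (F_t, e_t) for 2 ≤ t ≤ N, combined with the operation (F₁, e₁) ⊗ (F₂, e₂) = (F₂ F₁, F₂ e₁ + e₂). Then for every 2 ≤ t ≤ N + 1, writing ϑ₁ ⊗ ϑ₂ ⊗ ⋯ ⊗ ϑ_{t−1} = (F, e), one has e = x_t (and F = 0). -/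
open Matrix

/-- The state-propagation scan element combination: on pairs `(F, e)` with `F` an `n × n`
real matrix and `e ∈ ℝⁿ`, `(F₁, e₁) ⊗ (F₂, e₂) = (F₂ F₁, F₂ e₁ + e₂)`. -/
def stateOp (n : ℕ)
    (e₁ e₂ : Matrix (Fin n) (Fin n) ℝ × (Fin n → ℝ)) :
    Matrix (Fin n) (Fin n) ℝ × (Fin n → ℝ) :=
  (e₂.1 * e₁.1, e₂.1.mulVec e₁.2 + e₂.2)

/-- The combination `ϑ₁ ⊗ ϑ₂ ⊗ ⋯ ⊗ ϑ_{t-1}` of the scan elements from `1` to `t - 1`. -/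
def stateScan (n : ℕ)
    (ϑ : ℕ → Matrix (Fin n) (Fin n) ℝ × (Fin n → ℝ)) (t : ℕ) :
    Matrix (Fin n) (Fin n) ℝ × (Fin n → ℝ) :=
  (((List.range' 2 (t - 2)).map ϑ).foldl (stateOp n) (ϑ 1))

theorem stateScan_two (n : ℕ) (ϑ : ℕ → Matrix (Fin n) (Fin n) ℝ × (Fin n → ℝ)) :
    stateScan n ϑ 2 = ϑ 1 := rfl

theorem stateScan_succ (n : ℕ) (ϑ : ℕ → Matrix (Fin n) (Fin n) ℝ × (Fin n → ℝ))
    {t : ℕ} (ht : 2 ≤ t) :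
    stateScan n ϑ (t + 1) = stateOp n (stateScan n ϑ t) (ϑ t) := by
  obtain ⟨k, rfl⟩ := Nat.exists_eq_add_of_le ht
  have h : 2 + k + 1 - 2 = k + 1 := by lia
  simp [stateScan, h, List.range'_concat]

/-- Correctness of the parallel state-propagation scan: the trajectory of the forward affine
recursion `x_{t+1} = F_t x_t + e_t` is recovered from the prefix combinations of the scan
elements `ϑ₁ = (0, F₁ x₁ + e₁)`, `ϑ_t = (F_t, e_t)` for `2 ≤ t ≤ N`: writing
`ϑ₁ ⊗ ⋯ ⊗ ϑ_{t-1} = (F, e)`, one has `e = x_t` and `F = 0` for every `2 ≤ t ≤ N + 1`. -/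
theorem state_scan_correct (n N : ℕ) (hN : 1 ≤ N)
    (F : ℕ → Matrix (Fin n) (Fin n) ℝ) (e : ℕ → (Fin n → ℝ))
    (x : ℕ → (Fin n → ℝ)) (x₁ : Fin n → ℝ)
    (hx1 : x 1 = x₁)
    (hx : ∀ t, 1 ≤ t → t ≤ N → x (t + 1) = (F t).mulVec (x t) + e t)
    (ϑ : ℕ → Matrix (Fin n) (Fin n) ℝ × (Fin n → ℝ))
    (hϑ1 : ϑ 1 = (0, (F 1).mulVec x₁ + e 1))
    (hϑt : ∀ t, 2 ≤ t → t ≤ N → ϑ t = (F t, e t)) :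
    ∀ t, 2 ≤ t → t ≤ N + 1 →
      (stateScan n ϑ t).2 = x t ∧ (stateScan n ϑ t).1 = 0 := by
  intro t ht
  induction t, ht using Nat.le_induction with
  | base =>
    intro _
    rw [stateScan_two, hϑ1, hx 1 le_rfl hN, hx1]
    exact ⟨rfl, rfl⟩
  | succ t ht ih =>
    intro htN
    obtain ⟨h_snd, h_fst⟩ := ih (by lia)
    rw [stateScan_succ n ϑ ht, hϑt t ht (by lia), hx t (by lia) (by lia)]
    simp [stateOp, h_snd, h_fst]
end

section
/- Dynamic-programming splitting of conditional value functions: let j < t < i be natural numbers, and for each s with j ≤ s < i let ψ_s : ℝ^n × ℝ^m → ℝ≥0∞ be a stage cost and f_s : ℝ^n × ℝ^m → ℝ^n a dynamics map. For a ≤ b in [j, i] and x, y ∈ ℝ^n, define the conditional value function V_{a,b}(x, y) as the infimum of ∑_{s=a}^{b−1} ψ_s(x_s, u_s) over all control sequences (u_a, …, u_{b−1}) ∈ (ℝ^m)^{b−a} whose trajectory x_a = x, x_{s+1} = f_s(x_s, u_s) satisfies x_b = y (with infimum over the empty set equal to ∞). Then for all x, y ∈ ℝ^n: V_{j,i}(x,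 y) = ⨅_{z ∈ ℝ^n} (V_{j,t}(x, z) + V_{t,i}(z, y)). -/
open scoped ENNReal

/-- The controlled trajectory started at state `x` at time `a`, driven by the control
sequence `u`: `ctrlTraj f a x u k` is the state at time `a + k`. -/
def ctrlTraj {n m : ℕ} (f : ℕ → (Fin n → ℝ) → (Fin m → ℝ) → (Fin n → ℝ))
    (a : ℕ) (x : Fin n → ℝ) (u : ℕ → (Fin m → ℝ)) : ℕ → (Fin n → ℝ)
  | 0 => x
  | (k + 1) => f (a + k) (ctrlTraj f a x u k) (u (a + k))

/-- The conditional value function `V_{a,b}(x, y)`: the infimum of the accumulated stage cost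
`∑_{s=a}^{b-1} ψ_s(x_s, u_s)` over all control sequences whose trajectory starting from
`x_a = x` satisfies `x_b = y` (the infimum of the empty set being `∞`). -/
noncomputable def condVF {n m : ℕ}
    (ψ : ℕ → (Fin n → ℝ) → (Fin m → ℝ) → ℝ≥0∞)
    (f : ℕ → (Fin n → ℝ) → (Fin m → ℝ) → (Fin n → ℝ))
    (a b : ℕ) (x y : Fin n → ℝ) : ℝ≥0∞ :=
  ⨅ (u : ℕ → (Fin m → ℝ)) (_ : ctrlTraj f a x u (b - a) = y),
    ∑ s ∈ Finset.Ico a b, ψ s (ctrlTraj f a x u (s - a)) (u s)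

/-- Restarting a trajectory from its state after `p` steps continues it. -/
theorem ctrlTraj_add {n m : ℕ} (f : ℕ → (Fin n → ℝ) → (Fin m → ℝ) → (Fin n → ℝ))
    (a : ℕ) (x : Fin n → ℝ) (u : ℕ → (Fin m → ℝ)) (p q : ℕ) :
    ctrlTraj f a x u (p + q) = ctrlTraj f (a + p) (ctrlTraj f a x u p) u q := by
  induction q with
  | zero => rfl
  | succ q ih => rw [← Nat.add_assoc, ctrlTraj, ctrlTraj, ih, Nat.add_assoc]

/-- A trajectory depends only on the controls applied so far. -/
theorem ctrlTraj_congr {n m : ℕ} (f : ℕ → (Fin n → ℝ) → (Fin m → ℝ) → (Fin n → ℝ))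
    (a : ℕ) (x : Fin n → ℝ) {u v : ℕ → (Fin m → ℝ)} (k : ℕ)
    (h : ∀ s, a ≤ s → s < a + k → u s = v s) :
    ctrlTraj f a x u k = ctrlTraj f a x v k := by
  induction k with
  | zero => rfl
  | succ k ih =>
    simp only [ctrlTraj]
    rw [ih fun s h₁ h₂ => h s h₁ (by omega), h (a + k) (by omega) (by omega)]

/-- Restarting a trajectory at an intermediate time, in terms of absolute times. -/
theorem ctrlTraj_sub {n m : ℕ} (f : ℕ → (Fin n → ℝ) → (Fin m → ℝ) → (Fin n → ℝ))
    {a t s : ℕ} (hat : a ≤ t) (hts : t ≤ s) (x : Fin n → ℝ) (u : ℕ → (Fin m → ℝ)) :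
    ctrlTraj f a x u (s - a) = ctrlTraj f t (ctrlTraj f a x u (t - a)) u (s - t) := by
  rw [show s - a = (t - a) + (s - t) by omega, ctrlTraj_add, Nat.add_sub_cancel' hat]

/-- The accumulated cost splits at an intermediate time. -/
theorem sum_ctrlTraj_split {n m : ℕ} (ψ : ℕ → (Fin n → ℝ) → (Fin m → ℝ) → ℝ≥0∞)
    (f : ℕ → (Fin n → ℝ) → (Fin m → ℝ) → (Fin n → ℝ))
    {a t b : ℕ} (hat : a ≤ t) (htb : t ≤ b) (x : Fin n → ℝ) (u : ℕ → (Fin m → ℝ)) :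
    ∑ s ∈ Finset.Ico a b, ψ s (ctrlTraj f a x u (s - a)) (u s) =
      ∑ s ∈ Finset.Ico a t, ψ s (ctrlTraj f a x u (s - a)) (u s) +
        ∑ s ∈ Finset.Ico t b,
          ψ s (ctrlTraj f t (ctrlTraj f a x u (t - a)) u (s - t)) (u s) := by
  rw [← Finset.sum_Ico_consecutive _ hat htb]
  congr 1
  refine Finset.sum_congr rfl fun s hs => ?_
  rw [ctrlTraj_sub f hat (Finset.mem_Ico.1 hs).1]

/-- The cost of a control sequence bounds the value function at the state it reaches. -/
theorem condVF_le {n m : ℕ} (ψ : ℕ → (Fin n → ℝ) → (Fin m → ℝ) → ℝ≥0∞)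
    (f : ℕ → (Fin n → ℝ) → (Fin m → ℝ) → (Fin n → ℝ))
    (a b : ℕ) (x y : Fin n → ℝ) (u : ℕ → (Fin m → ℝ)) (hu : ctrlTraj f a x u (b - a) = y) :
    condVF ψ f a b x y ≤ ∑ s ∈ Finset.Ico a b, ψ s (ctrlTraj f a x u (s - a)) (u s) :=
  iInf₂_le u hu

/-- Dynamic-programming splitting of conditional value functions: for `j < t < i`,
`V_{j,i}(x, y) = ⨅_z (V_{j,t}(x, z) + V_{t,i}(z, y))`. -/
theorem condVF_split {n m : ℕ}
    (ψ : ℕ → (Fin n → ℝ) → (Fin m → ℝ) → ℝ≥0∞)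
    (f : ℕ → (Fin n → ℝ) → (Fin m → ℝ) → (Fin n → ℝ))
    (j t i : ℕ) (hjt : j < t) (hti : t < i) (x y : Fin n → ℝ) :
    condVF ψ f j i x y = ⨅ z : Fin n → ℝ, condVF ψ f j t x z + condVF ψ f t i z y := by
  apply le_antisymm
  · refine le_iInf fun z => ?_
    rw [condVF.eq_1 ψ f j t, condVF.eq_1 ψ f t i]
    simp only [ENNReal.iInf_add, ENNReal.add_iInf]
    refine le_iInf fun v => le_iInf fun hv => le_iInf fun u => le_iInf fun hu => ?_
    let w : ℕ → (Fin m → ℝ) := fun s => if s < t then u s else v s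
    have hw_left (s : ℕ) (hs : s < t) : w s = u s := if_pos hs
    have hw_right (s : ℕ) (hs : t ≤ s) : w s = v s := if_neg hs.not_gt
    have traj_left (k : ℕ) (hk : j + k ≤ t) : ctrlTraj f j x w k = ctrlTraj f j x u k :=
      ctrlTraj_congr f j x k fun s _ hs => hw_left s (by omega)
    have traj_right (k : ℕ) : ctrlTraj f t z w k = ctrlTraj f t z v k :=
      ctrlTraj_congr f t z k fun s hs _ => hw_right s hs
    have hz : ctrlTraj f j x w (t - j) = z := by rw [traj_left _ (by omega), hu]
    refine (condVF_le ψ f j i x y w ?_).trans_eq ?_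
    · rw [ctrlTraj_sub f hjt.le hti.le, hz, traj_right, hv]
    · rw [sum_ctrlTraj_split ψ f hjt.le hti.le, hz]
      congr 1 <;> refine Finset.sum_congr rfl fun s hs => ?_
      all_goals rw [Finset.mem_Ico] at hs
      · rw [traj_left _ (by omega), hw_left s hs.2]
      · rw [traj_right, hw_right s hs.1]
  · refine le_iInf₂ fun u hu => ?_
    rw [sum_ctrlTraj_split ψ f hjt.le hti.le]
    refine (iInf_le _ (ctrlTraj f j x u (t - j))).trans (add_le_add ?_ ?_)
    · exact condVF_le ψ f j t x _ u rfl
    · exact condVF_le ψ f t i _ y u (by rw [← ctrlTraj_sub f hjt.le hti.le, hu])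
end

section
/- Closure of positive semidefiniteness under the value-function combination rule: let A₁, A₂ ∈ M_n(ℝ), b₁, b₂, η₁, η₂ ∈ ℝ^n, and let C₁, C₂, Y₁, Y₂ ∈ M_n(ℝ) be symmetric positive semidefinite. Define Y₃ = A₁ᵀ (I + Y₂ C₁)⁻¹ Y₂ A₁ + Y₁ and C₃ = A₂ (I + C₁ Y₂)⁻¹ C₁ A₂ᵀ + C₂. Then Y₃ and C₃ are symmetric positive semidefinite. -/
open Matrix

/-- If `Y` and `C` are positive semidefinite, then so is `(1 + Y * C)⁻¹ * Y`. -/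
theorem Matrix.PosSemidef.inv_one_add_mul_mul {ι : Type*} [Fintype ι] [DecidableEq ι]
    {Y C : Matrix ι ι ℝ} (hY : Y.PosSemidef) (hC : C.PosSemidef) :
    ((1 + Y * C)⁻¹ * Y).PosSemidef := by
  obtain ⟨B, rfl⟩ : ∃ B : Matrix ι ι ℝ, Y = Bᴴ * B := by
    open scoped MatrixOrder in
    exact CStarAlgebra.nonneg_iff_eq_star_mul_self.mp hY.nonneg
  have hM : (1 + B * C * Bᴴ).PosDef :=
    PosDef.one.add_posSemidef (hC.mul_mul_conjTranspose_same B)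
  have hdet : IsUnit (1 + B * C * Bᴴ).det := (isUnit_iff_isUnit_det _).mp hM.isUnit
  have hdet' : IsUnit (1 + Bᴴ * B * C).det := by
    rwa [Matrix.mul_assoc, det_one_add_mul_comm]
  have hpush : (1 + Bᴴ * B * C) * Bᴴ = Bᴴ * (1 + B * C * Bᴴ) := by
    noncomm_ring
  have hinv : (1 + Bᴴ * B * C)⁻¹ * (Bᴴ * B) = Bᴴ * (1 + B * C * Bᴴ)⁻¹ * B := by
    rw [← Matrix.mul_assoc]
    congr 1
    calc (1 + Bᴴ * B * C)⁻¹ * Bᴴ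
        = (1 + Bᴴ * B * C)⁻¹ * (Bᴴ * (1 + B * C * Bᴴ) * (1 + B * C * Bᴴ)⁻¹) := by
          rw [mul_nonsing_inv_cancel_right _ _ hdet]
      _ = Bᴴ * (1 + B * C * Bᴴ)⁻¹ := by
          rw [← hpush, Matrix.mul_assoc _ Bᴴ, nonsing_inv_mul_cancel_left _ _ hdet']
  rw [hinv]
  exact hM.posSemidef.inv.conjTranspose_mul_mul_same B

/-- Closure of symmetric positive semidefiniteness under the value-function combination rule:
if `C₁, C₂, Y₁, Y₂` are symmetric positive semidefinite, then so are
`Y₃ = A₁ᵀ (I + Y₂ C₁)⁻¹ Y₂ A₁ + Y₁` and `C₃ = A₂ (I + C₁ Y₂)⁻¹ C₁ A₂ᵀ + C₂`. -/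
theorem combine_posSemidef (n : ℕ)
    (A₁ A₂ : Matrix (Fin n) (Fin n) ℝ)
    (b₁ b₂ η₁ η₂ : Fin n → ℝ)
    (C₁ C₂ Y₁ Y₂ : Matrix (Fin n) (Fin n) ℝ)
    (hC₁ : C₁.PosSemidef) (hC₂ : C₂.PosSemidef)
    (hY₁ : Y₁.PosSemidef) (hY₂ : Y₂.PosSemidef) :
    (A₁ᵀ * (1 + Y₂ * C₁)⁻¹ * Y₂ * A₁ + Y₁).PosSemidef ∧
    (A₂ * (1 + C₁ * Y₂)⁻¹ * C₁ * A₂ᵀ + C₂).PosSemidef := by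
  constructor
  · have h := (hY₂.inv_one_add_mul_mul hC₁).conjTranspose_mul_mul_same A₁
    rw [conjTranspose_eq_transpose_of_trivial, ← Matrix.mul_assoc] at h
    exact h.add hY₁
  · have h := (hC₁.inv_one_add_mul_mul hY₂).mul_mul_conjTranspose_same A₂
    rw [conjTranspose_eq_transpose_of_trivial, ← Matrix.mul_assoc] at h
    exact h.add hC₂
end

section
/- The value-function parameter combination operator is associative: on tuples (A, b, C, η, Y) with A ∈ M_n(ℝ), b, η ∈ ℝ^n, and C, Y ∈ M_n(ℝ) symmetric positive semidefinite, define e₁ ⊗ e₂ to be the tuple with A₃ = A₂(I + C₁Y₂)⁻¹A₁, Y₃ = A₁ᵀ(I + Y₂C₁)⁻¹Y₂A₁ + Y₁, C₃ = A₂(I + C₁Y₂)⁻¹C₁A₂ᵀ + C₂, η₃ = A₁ᵀ(I + Y₂C₁)⁻¹(η₂ − Y₂b₁) + η₁, b₃ = A₂(I + C₁Y₂)⁻¹(b₁ + C₁η₂) + b₂. Then for any three tuples e₁, e₂, e₃ whose C- and Y-components are symmetric positive semidefinite, (e₁ ⊗ e₂) ⊗ e₃ = e₁ ⊗ (e₂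 ⊗ e₃). -/
open Matrix

/-- A value-function scan element `(A, b, C, η, Y)` with `A, C, Y ∈ Mₙ(ℝ)` and `b, η ∈ ℝⁿ`. -/
structure VFElem (n : ℕ) where
  A : Matrix (Fin n) (Fin n) ℝ
  b : Fin n → ℝ
  C : Matrix (Fin n) (Fin n) ℝ
  η : Fin n → ℝ
  Y : Matrix (Fin n) (Fin n) ℝ

/-- The value-function parameter combination rule:
`A₃ = A₂(I + C₁Y₂)⁻¹A₁`, `Y₃ = A₁ᵀ(I + Y₂C₁)⁻¹Y₂A₁ + Y₁`, `C₃ = A₂(I + C₁Y₂)⁻¹C₁A₂ᵀ + C₂`,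
`η₃ = A₁ᵀ(I + Y₂C₁)⁻¹(η₂ − Y₂b₁) + η₁`, `b₃ = A₂(I + C₁Y₂)⁻¹(b₁ + C₁η₂) + b₂`. -/
noncomputable def VFElem.comb {n : ℕ} (e₁ e₂ : VFElem n) : VFElem n where
  A := e₂.A * (1 + e₁.C * e₂.Y)⁻¹ * e₁.A
  b := (e₂.A * (1 + e₁.C * e₂.Y)⁻¹).mulVec (e₁.b + e₁.C.mulVec e₂.η) + e₂.b
  C := e₂.A * (1 + e₁.C * e₂.Y)⁻¹ * e₁.C * e₂.Aᵀ + e₂.C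
  η := (e₁.Aᵀ * (1 + e₂.Y * e₁.C)⁻¹).mulVec (e₂.η - e₂.Y.mulVec e₁.b) + e₁.η
  Y := e₁.Aᵀ * (1 + e₂.Y * e₁.C)⁻¹ * e₂.Y * e₁.A + e₁.Y

namespace Matrix

theorem PosSemidef.transpose_eq_self {ι : Type*} {C : Matrix ι ι ℝ} (hC : C.PosSemidef) : Cᵀ = C := by
  simpa [IsHermitian, conjTranspose_eq_transpose_of_trivial] using hC.isHermitian

variable {ι : Type*} [Fintype ι] [DecidableEq ι]

theorem PosSemidef.isUnit_one_add_mul {C Y : Matrix ι ι ℝ}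
    (hC : C.PosSemidef) (hY : Y.PosSemidef) : IsUnit (1 + C * Y) := by
  rw [← mulVec_injective_iff_isUnit]
  refine (injective_iff_map_eq_zero (mulVecLin (1 + C * Y))).2 fun v hv => ?_
  have hv' : v + C *ᵥ (Y *ᵥ v) = 0 := by
    simpa [add_mulVec, mulVec_mulVec] using hv
  have hCw := hC.dotProduct_mulVec_nonneg (Y *ᵥ v)
  have hYv := hY.dotProduct_mulVec_nonneg v
  have hsum : (Y *ᵥ v) ⬝ᵥ (v + C *ᵥ (Y *ᵥ v)) = 0 := by rw [hv', dotProduct_zero]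
  rw [dotProduct_add, dotProduct_comm] at hsum
  simp only [star_trivial] at hCw hYv
  have hzero : star v ⬝ᵥ (Y *ᵥ v) = 0 := by
    rw [star_trivial]
    linarith
  have hYv0 : Y *ᵥ v = 0 := (hY.dotProduct_mulVec_zero_iff v).1 hzero
  simpa [hYv0] using hv'

theorem PosSemidef.transpose_inv_one_add_mul {C Y : Matrix ι ι ℝ}
    (hC : C.PosSemidef) (hY : Y.PosSemidef) : ((1 + C * Y)⁻¹)ᵀ = (1 + Y * C)⁻¹ := by
  rw [transpose_nonsing_inv, transpose_add, transpose_mul, transpose_one,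
    hC.transpose_eq_self, hY.transpose_eq_self]

theorem PosSemidef.inv_one_add_mul_mul_s9 {C Y : Matrix ι ι ℝ}
    (hC : C.PosSemidef) (hY : Y.PosSemidef) : ((1 + C * Y)⁻¹ * C).PosSemidef := by
  have hU := (isUnit_iff_isUnit_det _).1 (hY.isUnit_one_add_mul hC)
  have hYC : (C * Y * C).PosSemidef := by
    simpa [conjTranspose_eq_transpose_of_trivial, hC.transpose_eq_self] using
      hY.mul_mul_conjTranspose_same C
  have h := (hC.add hYC).mul_mul_conjTranspose_same (1 + C * Y)⁻¹
  rw [conjTranspose_eq_transpose_of_trivial, hC.transpose_inv_one_add_mul hY,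
    show C + C * Y * C = C * (1 + Y * C) by noncomm_ring,
    ← mul_assoc, mul_nonsing_inv_cancel_right _ _ hU] at h
  exact h

theorem eq_inv_mulVec_iff {M : Matrix ι ι ℝ} (hM : IsUnit M) (x y : ι → ℝ) :
    y = M⁻¹ *ᵥ x ↔ M *ᵥ y = x := by
  have hU := (isUnit_iff_isUnit_det _).1 hM
  constructor
  · rintro rfl
    rw [mulVec_mulVec, mul_nonsing_inv _ hU, one_mulVec]
  · rintro rfl
    rw [mulVec_mulVec, nonsing_inv_mul _ hU, one_mulVec]

end Matrix

namespace VFElem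

variable {n : ℕ}

/-- The affine two-point boundary relation of a scan element, linking the initial state `x` and
final costate `q` to the final state `y` and initial costate `p`. -/
def Rel (e : VFElem n) (x q y p : Fin n → ℝ) : Prop :=
  y = e.A *ᵥ x + e.b + e.C *ᵥ q ∧ p = e.η - e.Y *ᵥ x + e.Aᵀ *ᵥ q

theorem eq_of_rel {e f : VFElem n} (h : ∀ x q y p, e.Rel x q y p → f.Rel x q y p) : e = f := by
  have h' (x q) := h x q _ _ ⟨rfl, rfl⟩
  have h0 := h' 0 0
  simp only [Rel, mulVec_zero, zero_add, add_zero, sub_zero] at h0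
  have hA : e.A = f.A := mulVec_injective <| funext fun x => by
    simpa [h0.1] using (h' x 0).1
  have hY : e.Y = f.Y := mulVec_injective <| funext fun x => by
    simpa [h0.2] using (h' x 0).2
  have hC : e.C = f.C := mulVec_injective <| funext fun q => by
    simpa [h0.1] using (h' 0 q).1
  obtain ⟨hb, hη⟩ := h0
  cases e
  cases f
  simp_all

/-- A linear coupling of a state and a costate is solved by inverting `1 + C * Y`
and `1 + Y * C`. -/
theorem coupled_iff {C Y : Matrix (Fin n) (Fin n) ℝ} (hC : C.PosSemidef) (hY : Y.PosSemidef)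
    (u v z m : Fin n → ℝ) :
    (z = u + C *ᵥ m ∧ m = v - Y *ᵥ z) ↔
      (z = (1 + C * Y)⁻¹ *ᵥ (u + C *ᵥ v) ∧ m = (1 + Y * C)⁻¹ *ᵥ (v - Y *ᵥ u)) := by
  have hCY := hC.isUnit_one_add_mul hY
  have hYC := hY.isUnit_one_add_mul hC
  have key : ∀ z m, (z = u + C *ᵥ m ∧ m = v - Y *ᵥ z) →
      (z = (1 + C * Y)⁻¹ *ᵥ (u + C *ᵥ v) ∧ m = (1 + Y * C)⁻¹ *ᵥ (v - Y *ᵥ u)) := by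
    rintro z m ⟨hz, hm⟩
    rw [eq_inv_mulVec_iff hCY, eq_inv_mulVec_iff hYC]
    simp only [add_mulVec, one_mulVec, ← mulVec_mulVec]
    constructor
    · nth_rewrite 1 [hz]
      rw [hm, mulVec_sub]
      abel
    · nth_rewrite 1 [hm]
      rw [hz, mulVec_add]
      abel
  refine ⟨key z m, fun h => ?_⟩
  set z₀ := (1 + C * Y)⁻¹ *ᵥ (u + C *ᵥ v) with hz₀
  have hsol := (eq_inv_mulVec_iff hCY _ _).1 hz₀
  simp only [add_mulVec, one_mulVec, ← mulVec_mulVec] at hsol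
  have hpair : z₀ = u + C *ᵥ (v - Y *ᵥ z₀) := by
    rw [mulVec_sub, ← add_sub_assoc, ← hsol, add_sub_cancel_right]
  have hm : m = v - Y *ᵥ z₀ := h.2.trans (key z₀ _ ⟨hpair, rfl⟩).2.symm
  rw [h.1, hm]
  exact ⟨hpair, rfl⟩

theorem rel_comb_iff {e₁ e₂ : VFElem n} (hC : e₁.C.PosSemidef) (hY : e₂.Y.PosSemidef)
    (x q y p : Fin n → ℝ) :
    (e₁.comb e₂).Rel x q y p ↔ ∃ z m, e₁.Rel x m z p ∧ e₂.Rel z q y m := by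
  have hmid (z m : Fin n → ℝ) := coupled_iff hC hY (e₁.A *ᵥ x + e₁.b) (e₂.η + e₂.Aᵀ *ᵥ q) z m
  have hrel (z m : Fin n → ℝ) : (e₁.Rel x m z p ∧ e₂.Rel z q y m) ↔
      (z = e₁.A *ᵥ x + e₁.b + e₁.C *ᵥ m ∧ m = e₂.η + e₂.Aᵀ *ᵥ q - e₂.Y *ᵥ z) ∧
      (y = e₂.A *ᵥ z + e₂.b + e₂.C *ᵥ q ∧ p = e₁.η - e₁.Y *ᵥ x + e₁.Aᵀ *ᵥ m) := by
    simp only [Rel, sub_add_eq_add_sub]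
    tauto
  simp only [hrel, hmid]
  have hA : (e₁.comb e₂).Aᵀ = e₁.Aᵀ * (1 + e₂.Y * e₁.C)⁻¹ * e₂.Aᵀ := by
    simp only [comb, transpose_mul, hC.transpose_inv_one_add_mul hY, mul_assoc]
  simp only [and_assoc, exists_and_left, exists_eq_left, Rel, hA]
  simp only [comb, add_mulVec, mulVec_add, mulVec_sub, mulVec_mulVec, ← mul_assoc]
  refine and_congr (Eq.congr_right ?_) (Eq.congr_right ?_) <;> abel

theorem posSemidef_comb_C {e₁ e₂ : VFElem n} (hC₁ : e₁.C.PosSemidef) (hY₂ : e₂.Y.PosSemidef)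
    (hC₂ : e₂.C.PosSemidef) : (e₁.comb e₂).C.PosSemidef := by
  have h := (hC₁.inv_one_add_mul_mul_s9 hY₂).mul_mul_conjTranspose_same e₂.A
  rw [conjTranspose_eq_transpose_of_trivial, ← mul_assoc] at h
  exact h.add hC₂

theorem posSemidef_comb_Y {e₁ e₂ : VFElem n} (hC₁ : e₁.C.PosSemidef) (hY₂ : e₂.Y.PosSemidef)
    (hY₁ : e₁.Y.PosSemidef) : (e₁.comb e₂).Y.PosSemidef := by
  have h := (hY₂.inv_one_add_mul_mul_s9 hC₁).conjTranspose_mul_mul_same e₁.A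
  rw [conjTranspose_eq_transpose_of_trivial, ← mul_assoc] at h
  exact h.add hY₁

end VFElem

/-- The value-function parameter combination operator is associative on tuples whose
`C`- and `Y`-components are symmetric positive semidefinite. -/
theorem VFElem.comb_assoc {n : ℕ} (e₁ e₂ e₃ : VFElem n)
    (hC₁ : e₁.C.PosSemidef) (hY₁ : e₁.Y.PosSemidef)
    (hC₂ : e₂.C.PosSemidef) (hY₂ : e₂.Y.PosSemidef)
    (hC₃ : e₃.C.PosSemidef) (hY₃ : e₃.Y.PosSemidef) :
    (e₁.comb e₂).comb e₃ = e₁.comb (e₂.comb e₃) := by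
  refine eq_of_rel fun x q y p h => ?_
  obtain ⟨z₂, m₂, h₁₂, h₃⟩ := (rel_comb_iff (posSemidef_comb_C hC₁ hY₂ hC₂) hY₃ _ _ _ _).1 h
  obtain ⟨z₁, m₁, h₁, h₂⟩ := (rel_comb_iff hC₁ hY₂ _ _ _ _).1 h₁₂
  exact (rel_comb_iff hC₁ (posSemidef_comb_Y hC₂ hY₃ hY₂) _ _ _ _).2
    ⟨z₁, m₁, h₁, (rel_comb_iff hC₂ hY₃ _ _ _ _).2 ⟨z₂, m₂, h₂, h₃⟩⟩
end

section
/- Adjoint (co-state) formula for the gradient of the reduced cost: let f_t : ℝ^n × ℝ^m → ℝ^n and l_t, c_t : ℝ^n × ℝ^m → ℝ be continuously differentiable for 1 ≤ t ≤ N, l_{N+1} : ℝ^n → ℝ continuously differentiable, and x̂₁ ∈ ℝ^n. Given controls u = (u₁, …, u_N) ∈ (ℝ^m)^N, define states x₁(u) = x̂₁, x_{t+1}(u) = f_t(x_t(u), u_t), and the reduced cost J(u) = l_{N+1}(x_{N+1}(u)) + ∑_{t=1}^N [l_t(x_t(u), u_t) + c_t(x_t(u), u_t)]. Define co-states along the trajectory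 by λ_{N+1} = ∇ l_{N+1}(x_{N+1}(u)) and λ_t = ∇_x l_t + ∇_x c_t + (D_x f_t)ᵀ λ_{t+1}, all partial derivatives evaluated at (x_t(u), u_t). Then J is differentiable and for each 1 ≤ t ≤ N its partial gradient with respect to u_t equals d_t = ∇_u l_t(x_t(u), u_t) + ∇_u c_t(x_t(u), u_t) + (D_u f_t(x_t(u), u_t))ᵀ λ_{t+1}. -/
/-- `ocTraj f x1 u k` is the state `x_{k+1}` of the controlled system
`x₁ = x1`, `x_{t+1} = f_t(x_t, u_t)`. -/
def ocTraj {E U : Type*} (f : ℕ → E → U → E) (x1 : E) (u : ℕ → U) : ℕ → E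
  | 0 => x1
  | (k + 1) => f (k + 1) (ocTraj f x1 u k) (u (k + 1))

/-- The reduced cost `J(u) = l_{N+1}(x_{N+1}(u)) + ∑_{t=1}^N [l_t(x_t(u), u_t) + c_t(x_t(u), u_t)]`
with the states eliminated through the dynamics. -/
def redCost {E U : Type*} (f : ℕ → E → U → E) (l c : ℕ → E → U → ℝ)
    (lfin : E → ℝ) (x1 : E) (N : ℕ) (u : ℕ → U) : ℝ :=
  lfin (ocTraj f x1 u N)
    + ∑ t ∈ Finset.Icc 1 N,
        (l t (ocTraj f x1 u (t - 1)) (u t) + c t (ocTraj f x1 u (t - 1)) (u t))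

/-- The trajectory up to time `k` depends only on the controls `u 1, …, u k`. -/
theorem ocTraj_congr {E U : Type*} (f : ℕ → E → U → E) (x1 : E) {u v : ℕ → U} {k : ℕ}
    (h : ∀ s, 1 ≤ s → s ≤ k → u s = v s) : ocTraj f x1 u k = ocTraj f x1 v k := by
  induction k with
  | zero => rfl
  | succ k ih =>
    simp only [ocTraj]
    rw [ih fun s h1 hs => h s h1 (by omega), h (k + 1) (by omega) le_rfl]

section PartialMaps

variable {E U F : Type*} [NormedAddCommGroup E] [NormedSpace ℝ E] [NormedAddCommGroup U]
  [NormedSpace ℝ U] [NormedAddCommGroup F] [NormedSpace ℝ F]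

theorem Differentiable.apply_right {g : E → U → F}
    (hg : Differentiable ℝ fun p : E × U => g p.1 p.2) (x : E) (w : U) :
    DifferentiableAt ℝ (fun w => g x w) w :=
  (hg (x, w)).comp (f := fun w => (x, w)) w (by fun_prop)

theorem Differentiable.apply_left {g : E → U → F}
    (hg : Differentiable ℝ fun p : E × U => g p.1 p.2) (x : E) (w : U) :
    DifferentiableAt ℝ (fun x => g x w) x :=
  (hg (x, w)).comp (f := fun x => (x, w)) x (by fun_prop)

end PartialMaps

section CostGradient

variable {E U : Type*} [NormedAddCommGroup E] [InnerProductSpace ℝ E] [CompleteSpace E]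
  [NormedAddCommGroup U] [InnerProductSpace ℝ U] [CompleteSpace U]

/-- The states depend differentiably on a single control `u t`, and the derivative of the running
cost up to time `k`, completed by the co-state `lam (k + 1)` paired with the derivative of the state
`x_{k+1}`, does not depend on `k ≥ t`: it is the pairing with the adjoint gradient. -/
theorem exists_hasFDerivAt_ocTraj_sum {N : ℕ} {f : ℕ → E → U → E} {l c : ℕ → E → U → ℝ}
    (hf : ∀ t, Differentiable ℝ fun p : E × U => f t p.1 p.2)
    (hl : ∀ t, Differentiable ℝ fun p : E × U => l t p.1 p.2)
    (hc : ∀ t, Differentiable ℝ fun p : E × U => c t p.1 p.2)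
    {x1 : E} {u : ℕ → U} {lam : ℕ → E}
    (hlam : ∀ t, 1 ≤ t → t ≤ N →
        lam t = gradient (fun v => l t v (u t)) (ocTraj f x1 u (t - 1))
          + gradient (fun v => c t v (u t)) (ocTraj f x1 u (t - 1))
          + ContinuousLinearMap.adjoint
              (fderiv ℝ (fun v => f t v (u t)) (ocTraj f x1 u (t - 1))) (lam (t + 1)))
    {t k : ℕ} (ht : 1 ≤ t) (htk : t ≤ k) (hkN : k ≤ N) :
    ∃ (X' : U →L[ℝ] E) (S' : U →L[ℝ] ℝ),
      HasFDerivAt (fun w => ocTraj f x1 (Function.update u t w) k) X' (u t) ∧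
      HasFDerivAt (fun w => ∑ s ∈ Finset.Icc 1 k,
        (l s (ocTraj f x1 (Function.update u t w) (s - 1)) (Function.update u t w s)
          + c s (ocTraj f x1 (Function.update u t w) (s - 1)) (Function.update u t w s)))
        S' (u t) ∧
      ∀ v, inner ℝ (lam (k + 1)) (X' v) + S' v =
        inner ℝ (gradient (fun w => l t (ocTraj f x1 u (t - 1)) w) (u t)
          + gradient (fun w => c t (ocTraj f x1 u (t - 1)) w) (u t)
          + ContinuousLinearMap.adjoint
              (fderiv ℝ (fun w => f t (ocTraj f x1 u (t - 1)) w) (u t)) (lam (t + 1))) v := by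
  have traj_lt (w : U) {s : ℕ} (hs : s < t) :
      ocTraj f x1 (Function.update u t w) s = ocTraj f x1 u s :=
    ocTraj_congr f x1 fun r _ hr => Function.update_of_ne (by omega) _ _
  induction k, htk using Nat.le_induction with
  | base =>
    obtain ⟨j, rfl⟩ : ∃ j, t = j + 1 := ⟨t - 1, by omega⟩
    simp only [Nat.add_sub_cancel]
    have hF := ((hf (j + 1)).apply_right (ocTraj f x1 u j) (u (j + 1))).hasFDerivAt
    have hL := ((hl (j + 1)).apply_right (ocTraj f x1 u j) (u (j + 1))).hasFDerivAt
    have hC := ((hc (j + 1)).apply_right (ocTraj f x1 u j) (u (j + 1))).hasFDerivAt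
    refine ⟨_, _, hF.congr_of_eventuallyEq (.of_forall fun w => ?_),
      ((hL.add hC).const_add (∑ s ∈ Finset.Icc 1 j,
        (l s (ocTraj f x1 u (s - 1)) (u s)
          + c s (ocTraj f x1 u (s - 1)) (u s)))).congr_of_eventuallyEq
        (.of_forall fun w => ?_), fun v => ?_⟩
    · simp [ocTraj, traj_lt w (Nat.lt_succ_self j)]
    · dsimp only
      rw [Finset.sum_Icc_succ_top (by omega)]
      congr 1
      · refine Finset.sum_congr rfl fun s hs => ?_
        have hs := Finset.mem_Icc.mp hs
        rw [traj_lt w (by omega), Function.update_of_ne (by omega)]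
      · simp [traj_lt w (Nat.lt_succ_self j)]
    · simp only [inner_add_left, ContinuousLinearMap.adjoint_inner_left, gradient,
        InnerProductSpace.toDual_symm_apply, add_apply]
      ring
  | succ k htk ih =>
    obtain ⟨X', S', hX, hS, hXS⟩ := ih (by omega)
    have hF := ((hf (k + 1)).apply_left _ (u (k + 1))).hasFDerivAt.comp (u t) hX
    have hL := ((hl (k + 1)).apply_left _ (u (k + 1))).hasFDerivAt.comp (u t) hX
    have hC := ((hc (k + 1)).apply_left _ (u (k + 1))).hasFDerivAt.comp (u t) hX
    have update_succ (w : U) : Function.update u t w (k + 1) = u (k + 1) :=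
      Function.update_of_ne (by omega) _ _
    refine ⟨_, _, hF.congr_of_eventuallyEq (.of_forall fun w => ?_),
      (hS.add (hL.add hC)).congr_of_eventuallyEq (.of_forall fun w => ?_), fun v => ?_⟩
    · simp [ocTraj, update_succ]
    · simp [Finset.sum_Icc_succ_top, update_succ]
    · rw [← hXS v, hlam (k + 1) (by omega) hkN]
      simp only [inner_add_left, ContinuousLinearMap.adjoint_inner_left, gradient,
        InnerProductSpace.toDual_symm_apply, add_apply,
        ContinuousLinearMap.comp_apply, Nat.add_sub_cancel, Function.update_eq_self]
      ring

end CostGradient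

/-- Adjoint (co-state) formula for the gradient of the reduced cost: with co-states defined
backwards along the trajectory by `λ_{N+1} = ∇l_{N+1}(x_{N+1})` and
`λ_t = ∇ₓl_t + ∇ₓc_t + (Dₓf_t)ᵀλ_{t+1}`, the reduced cost is differentiable in each control
and its partial gradient with respect to `u_t` is
`d_t = ∇ᵤl_t + ∇ᵤc_t + (Dᵤf_t)ᵀλ_{t+1}`. -/
theorem reduced_cost_gradient (n m N : ℕ) (hN : 1 ≤ N)
    (f : ℕ → EuclideanSpace ℝ (Fin n) → EuclideanSpace ℝ (Fin m) → EuclideanSpace ℝ (Fin n))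
    (l c : ℕ → EuclideanSpace ℝ (Fin n) → EuclideanSpace ℝ (Fin m) → ℝ)
    (lfin : EuclideanSpace ℝ (Fin n) → ℝ)
    (hf : ∀ t, ContDiff ℝ 1 (fun p : EuclideanSpace ℝ (Fin n) × EuclideanSpace ℝ (Fin m) =>
        f t p.1 p.2))
    (hl : ∀ t, ContDiff ℝ 1 (fun p : EuclideanSpace ℝ (Fin n) × EuclideanSpace ℝ (Fin m) =>
        l t p.1 p.2))
    (hc : ∀ t, ContDiff ℝ 1 (fun p : EuclideanSpace ℝ (Fin n) × EuclideanSpace ℝ (Fin m) =>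
        c t p.1 p.2))
    (hlfin : ContDiff ℝ 1 lfin)
    (x1 : EuclideanSpace ℝ (Fin n)) (u : ℕ → EuclideanSpace ℝ (Fin m))
    (lam : ℕ → EuclideanSpace ℝ (Fin n))
    (hlamN : lam (N + 1) = gradient lfin (ocTraj f x1 u N))
    (hlam : ∀ t, 1 ≤ t → t ≤ N →
        lam t = gradient (fun v => l t v (u t)) (ocTraj f x1 u (t - 1))
          + gradient (fun v => c t v (u t)) (ocTraj f x1 u (t - 1))
          + ContinuousLinearMap.adjoint
              (fderiv ℝ (fun v => f t v (u t)) (ocTraj f x1 u (t - 1))) (lam (t + 1))) :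
    ∀ t, 1 ≤ t → t ≤ N →
      DifferentiableAt ℝ (fun w => redCost f l c lfin x1 N (Function.update u t w)) (u t) ∧
      gradient (fun w => redCost f l c lfin x1 N (Function.update u t w)) (u t)
        = gradient (fun w => l t (ocTraj f x1 u (t - 1)) w) (u t)
          + gradient (fun w => c t (ocTraj f x1 u (t - 1)) w) (u t)
          + ContinuousLinearMap.adjoint
              (fderiv ℝ (fun w => f t (ocTraj f x1 u (t - 1)) w) (u t)) (lam (t + 1)) := by
  intro t ht htN
  obtain ⟨X', S', hX, hS, hXS⟩ := exists_hasFDerivAt_ocTraj_sum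
    (fun t => (hf t).differentiable one_ne_zero) (fun t => (hl t).differentiable one_ne_zero)
    (fun t => (hc t).differentiable one_ne_zero) hlam ht htN le_rfl
  have hJ := ((hlfin.differentiable one_ne_zero _).hasFDerivAt.comp (u t) hX).add hS
  suffices h : HasGradientAt (fun w => redCost f l c lfin x1 N (Function.update u t w)) _ (u t) from
    ⟨h.differentiableAt, h.gradient⟩
  rw [hasGradientAt_iff_hasFDerivAt]
  refine hJ.congr_fderiv (ContinuousLinearMap.ext fun v => ?_)
  rw [InnerProductSpace.toDual_apply_apply, ← hXS v, hlamN]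
  simp [gradient, InnerProductSpace.toDual_symm_apply]
end
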